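/- Let k < ℓ with 2^k + 2^ℓ ≤ n and let λ ⊢_o n be such that R_k^k(λ) ≠ R_k^ℓ(λ) (the odd 2^k-hook and the odd 2^ℓ-hook of λ are removed from different components of Q_2^{(k)}(λ)). Then f_k(f_ℓ(λ)) = f_ℓ(f_k(λ)). -/

import Mathlib

namespace OddSym

open scoped Classical

/-- Remove one box from a row of size `p` (as multisets of parts). -/
def removeBox (lam : Multiset ℕ) (p : ℕ) : Multiset ℕ :=
  if p ≤ 1 then lam.erase p else (p - 1) ::ₘ lam.erase p

lemma removeBox_sum_lt {lam : Multiset ℕ} {p : ℕ} (hp : p ∈ lam) (h0 : 0 < p) :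
    (removeBox lam p).sum < lam.sum := by
  have h : p + (lam.erase p).sum = lam.sum := by
    conv_rhs => rw [← Multiset.cons_erase hp]
    simp [Multiset.sum_cons]
  unfold removeBox
  split
  · omega
  · simp only [Multiset.sum_cons]
    omega

/-- The number of standard Young tableaux of shape `lam`
(equivalently, the degree of the irreducible character of the symmetric
group labelled by `lam`), defined via the branching rule. -/
def degSYT (lam : Multiset ℕ) : ℕ :=
  if _h : lam = 0 then 1
  else ∑ p ∈ (lam.toFinset.filter (fun p => 0 < p)).attach, degSYT (removeBox lam p.1)
termination_by lam.sum
decreasing_by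
  have hp := p.2
  simp only [Finset.mem_filter, Multiset.mem_toFinset] at hp
  exact removeBox_sum_lt hp.1 hp.2

/-- `lam` is an odd partition: all parts positive and the number of standard
Young tableaux of shape `lam` (= the character degree) is odd. -/
def OddP (lam : Multiset ℕ) : Prop :=
  (∀ x ∈ lam, 0 < x) ∧ Odd (degSYT lam)

/-- The parts of `lam` sorted in weakly decreasing order. -/
def descList (lam : Multiset ℕ) : List ℕ :=
  (lam.sort (· ≤ ·)).reverse

/-- The beta-set (set of beta-numbers) of `lam` with `m` beads:
`{ lam_i + (m - i) : 1 ≤ i ≤ m }` where `lam` is padded with zero parts. -/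
def betaSet (lam : Multiset ℕ) (m : ℕ) : Finset ℕ :=
  (Finset.range m).image (fun i => (descList lam).getD i 0 + (m - 1 - i))

/-- `mu` is obtained from `lam` by removing an `e`-hook: in some beta-set of
`lam` a beta-number `x` is replaced by `x - e` (which is not a beta-number). -/
def IsHookRemoval (e : ℕ) (lam mu : Multiset ℕ) : Prop :=
  (∀ x ∈ lam, 0 < x) ∧ (∀ x ∈ mu, 0 < x) ∧ 0 < e ∧
  ∃ m x, Multiset.card lam ≤ m ∧ Multiset.card mu ≤ m ∧
    x ∈ betaSet lam m ∧ e ≤ x ∧ x - e ∉ betaSet lam m ∧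
    betaSet mu m = insert (x - e) ((betaSet lam m).erase x)

/-- The map `f_k` : for an odd partition `lam` with `2^k ≤ |lam|`, the unique
odd partition obtained from `lam` by removing a `2^k`-hook (junk value `0` if
no such partition exists). -/
noncomputable def fkOp (k : ℕ) (lam : Multiset ℕ) : Multiset ℕ :=
  if h : ∃ mu, IsHookRemoval (2 ^ k) lam mu ∧ OddP mu then h.choose else 0

/-- The partition encoded by a finite beta-set: each bead contributes a part
equal to the number of gaps below it. -/
def partOfBeta (S : Finset ℕ) : Multiset ℕ :=
  (S.val.map (fun b => b - (S.filter (fun a => a < b)).card)).filter (fun p => 0 < p)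

/-- The 2-quotient `(lam_0, lam_1)` of `lam`, computed from a beta-set with an
even number of beads via the two runners of the 2-abacus. -/
def quot2 (lam : Multiset ℕ) : Multiset ℕ × Multiset ℕ :=
  (partOfBeta (((betaSet lam (2 * Multiset.card lam)).filter (fun b => b % 2 = 0)).image
      (fun b => b / 2)),
   partOfBeta (((betaSet lam (2 * Multiset.card lam)).filter (fun b => b % 2 = 1)).image
      (fun b => b / 2)))

/-- The `e`-core of `lam`: push all beads of an `e`-abacus configuration for
`lam` up as far as possible. -/
def coreP (e : ℕ) (lam : Multiset ℕ) : Multiset ℕ :=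
  partOfBeta ((Finset.range (e * (Multiset.card lam + e))).filter
    (fun x => x / e <
      ((betaSet lam (Multiset.card lam + e)).filter (fun b => b % e = x % e)).card))

/-- Row `k` of the 2-quotient tower of `lam`: row 0 is `[lam]`, and row `k+1`
replaces each entry of row `k` by its 2-quotient pair. -/
def towerRow : ℕ → Multiset ℕ → List (Multiset ℕ)
  | 0, lam => [lam]
  | (k + 1), lam => (towerRow k lam).flatMap (fun mu => [(quot2 mu).1, (quot2 mu).2])

/-- `R_k^j(lam)`: the component of row `k` of the 2-quotient tower of `lam`
from which a `2^(j-k)`-hook is removed in the passage from `lam` to `f_j(lam)`;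
it is characterized by: row `k` for `f_j(lam)` is obtained from row `k` for
`lam` by replacing this component by its image under `f_(j-k)`. -/
noncomputable def Rcomp (k j : ℕ) (lam : Multiset ℕ) : Multiset ℕ :=
  if h : ∃ s, s < 2 ^ k ∧
      towerRow k (fkOp j lam) =
        (towerRow k lam).set s (fkOp (j - k) ((towerRow k lam).getD s 0))
  then (towerRow k lam).getD h.choose 0 else 0

/-- Move the bead at `x` down by `e` positions. -/
def moveBead (S : Finset ℕ) (x e : ℕ) : Finset ℕ := insert (x - e) (S.erase x)

/-- The beads of `S` which can be moved down by `e` positions. -/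
def hooks (e : ℕ) (S : Finset ℕ) : Finset ℕ := S.filter (fun x => e ≤ x ∧ x - e ∉ S)

lemma mem_hooks {e x : ℕ} {S : Finset ℕ} :
    x ∈ hooks e S ↔ x ∈ S ∧ e ≤ x ∧ x - e ∉ S := by
  simp [hooks]

lemma mem_moveBead {S : Finset ℕ} {x e y : ℕ} :
    y ∈ moveBead S x e ↔ y = x - e ∨ (y ≠ x ∧ y ∈ S) := by
  simp [moveBead]

lemma card_moveBead {S : Finset ℕ} {x e : ℕ} (h : x ∈ hooks e S) :
    (moveBead S x e).card = S.card := by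
  rw [mem_hooks] at h
  rw [moveBead, Finset.card_insert_of_notMem (by simp [h.2.2]), Finset.card_erase_add_one h.1]

/-- The number of gaps of `S` below `b`. -/
def gapsBelow (S : Finset ℕ) (b : ℕ) : ℕ := (Finset.range b \ S).card

lemma sub_card_eq_gapsBelow (S : Finset ℕ) (b : ℕ) :
    b - (S.filter (fun a => a < b)).card = gapsBelow S b := by
  have h : S.filter (fun a => a < b) = Finset.range b ∩ S := by
    ext a; simp [and_comm]
  have := Finset.card_sdiff_add_card_inter (Finset.range b) S
  rw [Finset.card_range] at this
  rw [h, gapsBelow]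
  omega

lemma partOfBeta_eq (S : Finset ℕ) :
    partOfBeta S = (S.val.map (gapsBelow S)).filter (fun p => 0 < p) := by
  simp only [partOfBeta, sub_card_eq_gapsBelow]

lemma mem_partOfBeta {S : Finset ℕ} {p : ℕ} :
    p ∈ partOfBeta S ↔ 0 < p ∧ ∃ b ∈ S, gapsBelow S b = p := by
  rw [partOfBeta_eq]
  simp [and_comm]

lemma pos_of_mem_partOfBeta (S : Finset ℕ) : ∀ x ∈ partOfBeta S, 0 < x :=
  fun _ hx => (mem_partOfBeta.1 hx).1

lemma card_partOfBeta_le (S : Finset ℕ) : Multiset.card (partOfBeta S) ≤ S.card := by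
  rw [partOfBeta_eq]
  refine (Multiset.card_le_card (Multiset.filter_le _ _)).trans ?_
  simp

lemma partOfBeta_insert {S : Finset ℕ} {b : ℕ} (h : ∀ a ∈ S, a < b) :
    partOfBeta (insert b S) =
      ((b - S.card) ::ₘ (partOfBeta S)).filter (fun p => 0 < p) := by
  have hb : b ∉ S := fun hb => lt_irrefl _ (h b hb)
  have h1 : gapsBelow (insert b S) b = b - S.card := by
    rw [← sub_card_eq_gapsBelow, Finset.filter_insert, if_neg (lt_irrefl _),
      Finset.filter_true_of_mem h]
  have h2 : S.val.map (gapsBelow (insert b S)) = S.val.map (gapsBelow S) := by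
    refine Multiset.map_congr rfl fun a ha => ?_
    have := h a ha
    rw [← sub_card_eq_gapsBelow, ← sub_card_eq_gapsBelow, Finset.filter_insert,
      if_neg (by omega)]
  rw [partOfBeta_eq, partOfBeta_eq, Finset.insert_val_of_notMem hb, Multiset.map_cons, h1, h2]
  simp [Multiset.filter_cons]

/-- The size of the partition encoded by `S`. -/
def size (S : Finset ℕ) : ℕ := (partOfBeta S).sum

lemma sum_filter_pos (m : Multiset ℕ) : (m.filter (fun p => 0 < p)).sum = m.sum := by
  induction m using Multiset.induction with
  | empty => simp
  | cons a m ih =>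
    rcases Nat.eq_zero_or_pos a with rfl | h
    · simp [ih]
    · simp [h, ih]

lemma filter_pos_eq_self {m : Multiset ℕ} (h : ∀ x ∈ m, 0 < x) :
    m.filter (fun p => 0 < p) = m := Multiset.filter_eq_self.2 h

lemma card_le_of_forall_lt {S : Finset ℕ} {b : ℕ} (h : ∀ a ∈ S, a < b) : S.card ≤ b := by
  simpa using Finset.card_le_card (fun a ha => Finset.mem_range.2 (h a ha) : S ⊆ Finset.range b)

lemma size_add_sum_range (S : Finset ℕ) :
    size S + ∑ i ∈ Finset.range S.card, i = ∑ b ∈ S, b := by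
  induction S using Finset.induction_on_max with
  | empty => simp [size, partOfBeta]
  | insert b S h ih =>
    have hb : b ∉ S := fun hb => lt_irrefl _ (h b hb)
    have hc := card_le_of_forall_lt h
    rw [Finset.card_insert_of_notMem hb, Finset.sum_range_succ, Finset.sum_insert hb, ← ih,
      size, partOfBeta_insert h, sum_filter_pos, Multiset.sum_cons, size]
    omega

lemma size_moveBead {S : Finset ℕ} {x e : ℕ} (h : x ∈ hooks e S) :
    size (moveBead S x e) + e = size S := by
  have h1 := size_add_sum_range S
  have h2 := size_add_sum_range (moveBead S x e)
  rw [card_moveBead h] at h2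
  rw [mem_hooks] at h
  rw [moveBead, Finset.sum_insert (by simp [h.2.2]), ← moveBead] at h2
  have h3 := Finset.add_sum_erase S (fun b => b) h.1
  omega

lemma gapsBelow_moveBead_of_ne {S : Finset ℕ} {x b : ℕ} (hx : x ∈ hooks 1 S) (hb : b ∈ S)
    (hbx : b ≠ x) : gapsBelow (moveBead S x 1) b = gapsBelow S b := by
  rw [mem_hooks] at hx
  obtain ⟨h1, h2, h3⟩ := hx
  have h4 : b ≠ x - 1 := by rintro rfl; exact h3 hb
  by_cases hlt : b < x
  · rw [gapsBelow, gapsBelow]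
    congr 1
    ext a
    simp only [Finset.mem_sdiff, Finset.mem_range, mem_moveBead]
    constructor
    · rintro ⟨h, h'⟩
      exact ⟨h, fun ha => h' (Or.inr ⟨by omega, ha⟩)⟩
    · rintro ⟨h, h'⟩
      exact ⟨h, by rintro (rfl | ⟨-, ha⟩); omega; exact h' ha⟩
  · have e1 : (moveBead S x 1).filter (fun a => a < b) =
        insert (x - 1) ((S.filter (fun a => a < b)).erase x) := by
      ext a
      simp only [Finset.mem_filter, mem_moveBead, Finset.mem_insert, Finset.mem_erase]
      constructor
      · rintro ⟨rfl | ⟨h, h'⟩, h''⟩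
        · exact Or.inl rfl
        · exact Or.inr ⟨h, h', h''⟩
      · rintro (rfl | ⟨h, h', h''⟩)
        · exact ⟨Or.inl rfl, by omega⟩
        · exact ⟨Or.inr ⟨h, h'⟩, h''⟩
    rw [← sub_card_eq_gapsBelow, ← sub_card_eq_gapsBelow, e1,
      Finset.card_insert_of_notMem (by simp [h3]), Finset.card_erase_add_one]
    simp [h1]; omega

lemma gapsBelow_of_mem_hooks {S : Finset ℕ} {x : ℕ} (hx : x ∈ hooks 1 S) :
    gapsBelow S x = gapsBelow (moveBead S x 1) (x - 1) + 1 := by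
  rw [mem_hooks] at hx
  obtain ⟨h1, h2, h3⟩ := hx
  have : Finset.range x \ S = insert (x - 1) (Finset.range (x - 1) \ moveBead S x 1) := by
    ext a
    simp only [Finset.mem_sdiff, Finset.mem_range, mem_moveBead, Finset.mem_insert]
    constructor
    · rintro ⟨h, h'⟩
      by_cases ha : a = x - 1
      · exact Or.inl ha
      · exact Or.inr ⟨by omega, by simp [ha, h']⟩
    · rintro (rfl | ⟨h, h'⟩)
      · exact ⟨by omega, h3⟩
      · exact ⟨by omega, fun ha => h' (Or.inr ⟨by omega, ha⟩)⟩
  rw [gapsBelow, this, Finset.card_insert_of_notMem (by simp), gapsBelow]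

lemma partOfBeta_moveBead {S : Finset ℕ} {x : ℕ} (hx : x ∈ hooks 1 S) :
    partOfBeta (moveBead S x 1) = removeBox (partOfBeta S) (gapsBelow S x) := by
  have hx' := mem_hooks.1 hx
  have h1 : S.val = x ::ₘ (S.erase x).val := by
    rw [Finset.erase_val, Multiset.cons_erase hx'.1]
  have h2 : (moveBead S x 1).val = (x - 1) ::ₘ (S.erase x).val := by
    rw [moveBead, Finset.insert_val_of_notMem (by simp [hx'.2.2])]
  have h3 : (S.erase x).val.map (gapsBelow (moveBead S x 1)) =
      (S.erase x).val.map (gapsBelow S) := by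
    refine Multiset.map_congr rfl fun b hb => ?_
    have hb' : b ∈ S.erase x := hb
    exact gapsBelow_moveBead_of_ne hx (Finset.mem_of_mem_erase hb') (Finset.ne_of_mem_erase hb')
  rw [partOfBeta_eq, partOfBeta_eq, h1, h2, Multiset.map_cons, Multiset.map_cons, h3,
    gapsBelow_of_mem_hooks hx]
  generalize gapsBelow (moveBead S x 1) (x - 1) = g
  unfold removeBox
  rcases Nat.eq_zero_or_pos g with rfl | hg
  · simp
  · simp [hg, show g ≠ 0 by omega]

lemma gapsBelow_lt_of_mem_hooks {S : Finset ℕ} {x y : ℕ} (hy : y ∈ hooks 1 S) (h : x < y) :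
    gapsBelow S x < gapsBelow S y := by
  rw [mem_hooks] at hy
  refine Finset.card_lt_card (Finset.ssubset_iff_of_subset ?_ |>.2 ⟨y - 1, ?_, ?_⟩)
  · intro a
    simp only [Finset.mem_sdiff, Finset.mem_range]
    exact fun ha => ⟨by omega, ha.2⟩
  · simp only [Finset.mem_sdiff, Finset.mem_range]
    exact ⟨by omega, hy.2.2⟩
  · simp only [Finset.mem_sdiff, Finset.mem_range]
    omega

lemma exists_mem_hooks_gapsBelow {S : Finset ℕ} {b : ℕ} (hb : b ∈ S) (h : 0 < gapsBelow S b) :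
    ∃ x ∈ hooks 1 S, gapsBelow S x = gapsBelow S b := by
  induction b with
  | zero => simp [gapsBelow] at h
  | succ b ih =>
    by_cases hb' : b ∈ S
    · have : gapsBelow S (b + 1) = gapsBelow S b := by
        rw [gapsBelow, Finset.range_add_one, Finset.insert_sdiff_of_mem _ hb', gapsBelow]
      rw [this] at h ⊢
      exact ih hb' h
    · exact ⟨b + 1, mem_hooks.2 ⟨hb, by omega, by simpa using hb'⟩, rfl⟩

/-- The parity of the degree of the character encoded by `S`. -/
def deg (S : Finset ℕ) : ZMod 2 := (degSYT (partOfBeta S) : ZMod 2)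

lemma deg_eq_one_of_size_eq_zero {S : Finset ℕ} (h : size S = 0) : deg S = 1 := by
  have : partOfBeta S = 0 := by
    rw [size, Multiset.sum_eq_zero_iff] at h
    refine Multiset.eq_zero_of_forall_notMem fun a ha => ?_
    exact absurd (h a ha) (pos_of_mem_partOfBeta S a ha).ne'
  rw [deg, this, degSYT]
  simp

lemma deg_eq_sum_hooks_one {S : Finset ℕ} (h : 1 ≤ size S) :
    deg S = ∑ x ∈ hooks 1 S, deg (moveBead S x 1) := by
  have h0 : partOfBeta S ≠ 0 := by
    intro h0; rw [size, h0] at h; simp at h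
  rw [deg, degSYT, dif_neg h0,
    Finset.sum_attach _ (fun p => degSYT (removeBox (partOfBeta S) p)), Nat.cast_sum]
  symm
  refine Finset.sum_bij (fun x _ => gapsBelow S x) ?_ ?_ ?_ ?_
  · intro x hx
    have hp : 0 < gapsBelow S x := by rw [gapsBelow_of_mem_hooks hx]; omega
    simp only [Finset.mem_filter, Multiset.mem_toFinset]
    exact ⟨mem_partOfBeta.2 ⟨hp, x, (mem_hooks.1 hx).1, rfl⟩, hp⟩
  · intro x hx y hy hxy
    rcases lt_trichotomy x y with h | h | h
    · exact absurd hxy (gapsBelow_lt_of_mem_hooks hy h).ne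
    · exact h
    · exact absurd hxy (gapsBelow_lt_of_mem_hooks hx h).ne'
  · intro p hp
    simp only [Finset.mem_filter, Multiset.mem_toFinset] at hp
    obtain ⟨hp, b, hb, rfl⟩ := mem_partOfBeta.1 hp.1
    obtain ⟨x, hx, h⟩ := exists_mem_hooks_gapsBelow hb hp
    exact ⟨x, hx, h⟩
  · intro x hx
    rw [deg, partOfBeta_moveBead hx]

lemma sum_sum_hooks {e : ℕ} (he : 0 < e) (S : Finset ℕ) (g : Finset ℕ → ZMod 2) :
    ∑ x ∈ hooks e S, ∑ y ∈ hooks e (moveBead S x e), g (moveBead (moveBead S x e) y e) =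
      ∑ x ∈ hooks (2 * e) S, g (moveBead S x (2 * e)) := by
  rw [Finset.sum_sigma']
  set P := (hooks e S).sigma (fun x => hooks e (moveBead S x e)) with hP
  have memP : ∀ p : (Σ _ : ℕ, ℕ), p ∈ P ↔ p.1 ∈ hooks e S ∧ p.2 ∈ hooks e (moveBead S p.1 e) := by
    intro p; rw [hP, Finset.mem_sigma]
  rw [← Finset.sum_filter_add_sum_filter_not P (fun p => p.2 ∈ hooks e S)]
  have h1 : ∑ p ∈ P.filter (fun p => p.2 ∈ hooks e S),
      g (moveBead (moveBead S p.1 e) p.2 e) = 0 := by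
    refine Finset.sum_involution (fun p _ => ⟨p.2, p.1⟩) ?_ ?_ ?_ ?_
    · rintro ⟨x, y⟩ h
      have : moveBead (moveBead S x e) y e = moveBead (moveBead S y e) x e := by
        simp only [Finset.mem_filter, memP, mem_hooks, mem_moveBead] at h
        ext a
        simp only [mem_moveBead]
        grind
      simp only [this]
      exact CharTwo.add_self_eq_zero _
    · rintro ⟨x, y⟩ h _ h'
      simp only [Finset.mem_filter, memP, mem_hooks, mem_moveBead] at h
      simp only [Sigma.mk.injEq] at h'
      grind
    · rintro ⟨x, y⟩ h
      simp only [Finset.mem_filter, memP, mem_hooks, mem_moveBead] at h ⊢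
      grind
    · rintro ⟨x, y⟩ h
      rfl
  rw [h1, zero_add]
  refine Finset.sum_bij' (fun p _ => max p.1 p.2)
    (fun z _ => if z - e ∈ S then ⟨z - e, z⟩ else ⟨z, z - e⟩) ?_ ?_ ?_ ?_ ?_
  · rintro ⟨x, y⟩ h
    simp only [Finset.mem_filter, memP, mem_hooks, mem_moveBead] at h ⊢
    grind
  · intro z h
    simp only [mem_hooks] at h
    split_ifs <;> simp only [Finset.mem_filter, memP, mem_hooks, mem_moveBead] <;> grind
  · rintro ⟨x, y⟩ h
    simp only [Finset.mem_filter, memP, mem_hooks, mem_moveBead] at h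
    split_ifs <;> simp only [Sigma.mk.injEq, heq_eq_eq] <;> grind
  · intro z h
    simp only [mem_hooks] at h
    split_ifs <;> simp
  · rintro ⟨x, y⟩ h
    simp only [Finset.mem_filter, memP, mem_hooks, mem_moveBead] at h
    congr 1
    ext a
    simp only [mem_moveBead]
    grind

lemma deg_eq_sum_hooks (k : ℕ) {S : Finset ℕ} (h : 2 ^ k ≤ size S) :
    deg S = ∑ x ∈ hooks (2 ^ k) S, deg (moveBead S x (2 ^ k)) := by
  induction k generalizing S with
  | zero => simpa using deg_eq_sum_hooks_one (by simpa using h)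
  | succ k ih =>
    have h2 : 2 ^ (k + 1) = 2 * 2 ^ k := by ring
    rw [h2] at h ⊢
    rw [← sum_sum_hooks (by positivity), ih (by omega)]
    refine Finset.sum_congr rfl fun x hx => ih ?_
    have := size_moveBead hx
    omega

lemma le_size_of_mem_hooks {e x : ℕ} {S : Finset ℕ} (h : x ∈ hooks e S) : e ≤ size S := by
  have := size_moveBead h
  omega

lemma two_mul_le_size {e x y : ℕ} {S : Finset ℕ} (hx : x ∈ hooks e S)
    (hy : y ∈ hooks e S) (hxy : x ≠ y) : 2 * e ≤ size S := by
  have h : y ∈ hooks e (moveBead S x e) := by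
    simp only [mem_hooks, mem_moveBead] at *
    grind
  have h1 := size_moveBead hx
  have h2 := le_size_of_mem_hooks h
  omega

lemma zmod_two_eq_one {a : ZMod 2} (h : a ≠ 0) : a = 1 := by
  revert a; decide

lemma exists_hook_of_deg {k : ℕ} {S : Finset ℕ} (h : deg S = 1) (hk : 2 ^ k ≤ size S) :
    ∃ x ∈ hooks (2 ^ k) S, deg (moveBead S x (2 ^ k)) = 1 := by
  rw [deg_eq_sum_hooks k hk] at h
  obtain ⟨x, hx, hx'⟩ := Finset.exists_ne_zero_of_sum_ne_zero (by rw [h]; exact one_ne_zero)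
  exact ⟨x, hx, zmod_two_eq_one hx'⟩

lemma path_cases {e u v x w : ℕ} {S : Finset ℕ} (he : 2 ≤ e)
    (huniq : ∀ z ∈ hooks e S, z = v) (hv : v ∈ hooks e S) (hx : x ∈ hooks 1 S)
    (hw : w ∈ hooks e (moveBead S x 1))
    (hcore : hooks e (moveBead (moveBead S x 1) w e) = ∅)
    (huu : ∀ z ∈ hooks 1 (moveBead S v e),
      moveBead (moveBead S v e) z 1 = moveBead (moveBead S x 1) w e → z = u) :
    (x = v ∧ u = v - e) ∨ (x = v + 1 - e ∧ u = v + 1) ∨ x = u := by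
  have hnc : ∀ z, z ∉ hooks e (moveBead (moveBead S x 1) w e) := by simp [hcore]
  have key : ∀ z, z ∈ hooks 1 (moveBead S v e) →
      (∀ a, a ∈ moveBead (moveBead S v e) z 1 ↔ a ∈ moveBead (moveBead S x 1) w e) → z = u :=
    fun z h1 h2 => huu z h1 (Finset.ext h2)
  clear huu hcore
  simp only [mem_hooks, mem_moveBead] at *
  have hncv := hnc v
  clear hnc
  by_cases hw1 : w = x - 1
  · subst hw1
    by_cases hxe : x - e ∈ S
    · clear huniq key
      grind
    · have hxv : x = v := huniq x ⟨hx.1, by omega, hxe⟩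
      subst hxv
      refine Or.inl ⟨rfl, (key (x - e) ?_ ?_).symm⟩ <;> clear huniq key <;> grind
  · by_cases hwe : w - e = x
    · have hvw : v + 1 = w := by
        clear huniq key
        grind
      subst hvw
      refine Or.inr (Or.inl ⟨by omega, (key (v + 1) ?_ ?_).symm⟩) <;> clear huniq key <;> grind
    · have hwv : w = v := huniq w (by clear huniq key; grind)
      subst hwv
      refine Or.inr (Or.inr (key x ?_ ?_)) <;> clear huniq key <;> grind

lemma hook_one_unique {S : Finset ℕ} (h : deg S = 1) {x y : ℕ}
    (hx : x ∈ hooks 1 S) (hx1 : deg (moveBead S x 1) = 1)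
    (hy : y ∈ hooks 1 S) (hy1 : deg (moveBead S y 1) = 1) : x = y := by
  induction hn : size S using Nat.strong_induction_on generalizing S x y with
  | _ n ih =>
  have hn1 : 1 ≤ size S := le_size_of_mem_hooks hx
  obtain ⟨a, ha1, ha2⟩ : ∃ a, 2 ^ a ≤ size S ∧ size S < 2 * 2 ^ a :=
    ⟨Nat.log 2 (size S), Nat.pow_log_le_self 2 (by omega), by
      rw [mul_comm, ← pow_succ]; exact Nat.lt_pow_succ_log_self (by norm_num) _⟩
  by_contra hxy
  rcases Nat.eq_zero_or_pos a with rfl | ha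
  · have := two_mul_le_size hx hy hxy
    omega
  have he : 2 ≤ 2 ^ a := by
    calc 2 = 2 ^ 1 := rfl
      _ ≤ 2 ^ a := Nat.pow_le_pow_right (by norm_num) ha
  obtain ⟨v, hv, hv1⟩ := exists_hook_of_deg h ha1
  have huniq : ∀ z ∈ hooks (2 ^ a) S, z = v := by
    intro z hz
    by_contra hzv
    have := two_mul_le_size hz hv hzv
    omega
  have hsv := size_moveBead hv
  rcases ha1.eq_or_lt with hea | hea
  · have hT : ∀ z, z ∉ hooks 1 (moveBead S v (2 ^ a)) := by
      intro z hz
      have := le_size_of_mem_hooks hz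
      omega
    have hsub : ∀ z ∈ hooks 1 S, z = v ∨ z = v - 2 ^ a + 1 := by
      intro z hz
      have := hT z
      simp only [mem_hooks, mem_moveBead] at *
      grind
    have hpair : hooks 1 S = {x, y} := by
      ext z
      simp only [Finset.mem_insert, Finset.mem_singleton]
      constructor
      · intro hz
        have := hsub z hz
        have := hsub x hx
        have := hsub y hy
        omega
      · rintro (rfl | rfl) <;> assumption
    rw [deg_eq_sum_hooks_one hn1, hpair, Finset.sum_pair hxy, hx1, hy1] at h
    revert h; decide
  · obtain ⟨u, hu, hu1⟩ := exists_hook_of_deg (k := 0) hv1 (by simp; omega)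
    rw [pow_zero] at hu hu1
    have main : ∀ x, x ∈ hooks 1 S → deg (moveBead S x 1) = 1 →
        (x = v ∧ u = v - 2 ^ a) ∨ (x = v + 1 - 2 ^ a ∧ u = v + 1) ∨ x = u := by
      intro x hx hx1
      have hsx := size_moveBead hx
      obtain ⟨w, hw, hw1⟩ := exists_hook_of_deg (k := a) hx1 (by omega)
      have hsw := size_moveBead hw
      refine path_cases he huniq hv hx hw ?_ ?_
      · refine Finset.eq_empty_of_forall_notMem fun z hz => ?_
        have := le_size_of_mem_hooks hz
        omega
      · intro z hz hzeq
        exact ih _ (by omega) hv1 hz (by rw [hzeq, hw1]) hu hu1 rfl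
    have m1 := main x hx hx1
    have m2 := main y hy hy1
    have hxm := mem_hooks.1 hx
    have hym := mem_hooks.1 hy
    have hum := mem_hooks.1 hu
    have hvm := mem_hooks.1 hv
    simp only [mem_moveBead] at hum
    clear main ih huniq
    grind

/-- Add a bead at the bottom of `S`, shifting the other beads up. -/
def shiftBeads (S : Finset ℕ) : Finset ℕ := insert 0 (S.image (· + 1))

lemma mem_shiftBeads {S : Finset ℕ} {y : ℕ} : y ∈ shiftBeads S ↔ y = 0 ∨ ∃ a ∈ S, a + 1 = y := by
  simp [shiftBeads]

lemma length_descList (lam : Multiset ℕ) : (descList lam).length = Multiset.card lam := by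
  simp [descList]

lemma mem_descList {lam : Multiset ℕ} {p : ℕ} : p ∈ descList lam ↔ p ∈ lam := by
  simp [descList]

lemma descList_cons {lam : Multiset ℕ} {p : ℕ} (h : ∀ q ∈ lam, q ≤ p) :
    descList (p ::ₘ lam) = p :: descList lam := by
  have h1 : (p ::ₘ lam).sort (· ≤ ·) = lam.sort (· ≤ ·) ++ [p] := by
    refine List.Perm.eq_of_pairwise' (r := (· ≤ ·)) (Multiset.pairwise_sort _ _) ?_ ?_
    · rw [List.pairwise_append]
      refine ⟨Multiset.pairwise_sort _ _, List.pairwise_singleton _ _, ?_⟩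
      intro a ha b hb
      rw [List.mem_singleton] at hb
      subst hb
      exact h a ((Multiset.mem_sort _).1 ha)
    · rw [← Multiset.coe_eq_coe, Multiset.sort_eq, ← Multiset.coe_add, Multiset.sort_eq,
        Multiset.coe_singleton, add_comm, Multiset.singleton_add]
  rw [descList, h1, List.reverse_append, descList]
  rfl

lemma getD_descList_eq_zero {lam : Multiset ℕ} {i : ℕ} (h : Multiset.card lam ≤ i) :
    (descList lam).getD i 0 = 0 := by
  rw [List.getD_eq_default]
  rwa [length_descList]

lemma getD_descList_le {lam : Multiset ℕ} {p i : ℕ} (h : ∀ q ∈ lam, q ≤ p) :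
    (descList lam).getD i 0 ≤ p := by
  by_cases hi : i < (descList lam).length
  · rw [List.getD_eq_getElem _ _ hi]
    exact h _ (mem_descList.1 (List.getElem_mem hi))
  · rw [List.getD_eq_default _ _ (by omega)]
    exact Nat.zero_le _

lemma betaSet_zero (m : ℕ) : betaSet 0 m = Finset.range m := by
  ext a
  simp only [betaSet, Finset.mem_image, Finset.mem_range,
    getD_descList_eq_zero (lam := 0) (Nat.zero_le _), zero_add]
  constructor
  · rintro ⟨i, hi, rfl⟩
    omega
  · intro ha
    exact ⟨m - 1 - a, by omega, by omega⟩

lemma betaSet_cons {lam : Multiset ℕ} {p : ℕ} (h : ∀ q ∈ lam, q ≤ p) (m : ℕ) :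
    betaSet (p ::ₘ lam) (m + 1) = insert (p + m) (betaSet lam m) := by
  ext a
  simp only [betaSet, Finset.mem_image, Finset.mem_range, Finset.mem_insert, descList_cons h]
  constructor
  · rintro ⟨i, hi, rfl⟩
    cases i with
    | zero => left; simp
    | succ i => exact Or.inr ⟨i, by omega, by simp; omega⟩
  · rintro (rfl | ⟨i, hi, rfl⟩)
    · exact ⟨0, by omega, by simp⟩
    · exact ⟨i + 1, by omega, by simp; omega⟩

lemma lt_of_mem_betaSet {lam : Multiset ℕ} {p m : ℕ} (h : ∀ q ∈ lam, q ≤ p) :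
    ∀ a ∈ betaSet lam m, a < p + m := by
  intro a ha
  simp only [betaSet, Finset.mem_image, Finset.mem_range] at ha
  obtain ⟨i, hi, rfl⟩ := ha
  have := getD_descList_le (i := i) h
  omega

lemma betaSet_succ {lam : Multiset ℕ} {m : ℕ} (h : Multiset.card lam ≤ m) :
    betaSet lam (m + 1) = shiftBeads (betaSet lam m) := by
  ext a
  simp only [betaSet, Finset.mem_image, Finset.mem_range, mem_shiftBeads]
  constructor
  · rintro ⟨i, hi, rfl⟩
    rcases Nat.lt_succ_iff_lt_or_eq.1 hi with hi | rfl
    · exact Or.inr ⟨_, ⟨i, hi, rfl⟩, by omega⟩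
    · left; rw [getD_descList_eq_zero h]; omega
  · rintro (rfl | ⟨_, ⟨i, hi, rfl⟩, rfl⟩)
    · exact ⟨m, by omega, by rw [getD_descList_eq_zero h]; omega⟩
    · exact ⟨i, by omega, by omega⟩

/-- Induction on multisets of naturals, adding a maximal element at each step. -/
lemma multiset_induction_on_max {P : Multiset ℕ → Prop} (zero : P 0)
    (cons : ∀ p lam, (∀ q ∈ lam, q ≤ p) → P lam → P (p ::ₘ lam)) (lam : Multiset ℕ) : P lam := by
  induction hn : Multiset.card lam generalizing lam with
  | zero => rw [Multiset.card_eq_zero.1 hn]; exact zero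
  | succ n ih =>
    have hne : lam ≠ 0 := by rintro rfl; simp at hn
    obtain ⟨p, hp, hmax⟩ := Multiset.exists_max_image id (s := lam) hne
    have := Multiset.cons_erase hp
    rw [← this]
    refine cons _ _ (fun q hq => hmax q (Multiset.mem_of_mem_erase hq)) (ih _ ?_)
    rw [Multiset.card_erase_of_mem hp, hn]; rfl

lemma card_betaSet {lam : Multiset ℕ} {m : ℕ} (h : Multiset.card lam ≤ m) :
    (betaSet lam m).card = m := by
  induction lam using multiset_induction_on_max generalizing m with
  | zero => simp [betaSet_zero]
  | cons p lam hp ih =>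
    rw [Multiset.card_cons] at h
    obtain ⟨m, rfl⟩ : ∃ m', m = m' + 1 := ⟨m - 1, by omega⟩
    rw [betaSet_cons hp, Finset.card_insert_of_notMem, ih (by omega)]
    exact fun h' => lt_irrefl _ (lt_of_mem_betaSet hp _ h')

lemma partOfBeta_range (m : ℕ) : partOfBeta (Finset.range m) = 0 := by
  induction m with
  | zero => simp [partOfBeta]
  | succ m ih =>
    rw [Finset.range_add_one, partOfBeta_insert (by simp), ih]
    simp

lemma partOfBeta_betaSet {lam : Multiset ℕ} {m : ℕ} (hpos : ∀ x ∈ lam, 0 < x)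
    (h : Multiset.card lam ≤ m) : partOfBeta (betaSet lam m) = lam := by
  induction lam using multiset_induction_on_max generalizing m with
  | zero => rw [betaSet_zero, partOfBeta_range]
  | cons p lam hp ih =>
    rw [Multiset.card_cons] at h
    obtain ⟨m, rfl⟩ : ∃ m', m = m' + 1 := ⟨m - 1, by omega⟩
    rw [betaSet_cons hp, partOfBeta_insert (lt_of_mem_betaSet hp), card_betaSet (by omega),
      ih (fun x hx => hpos x (Multiset.mem_cons_of_mem hx)) (by omega), Nat.add_sub_cancel,
      filter_pos_eq_self hpos]

lemma le_of_mem_partOfBeta {S : Finset ℕ} {b : ℕ} (h : ∀ a ∈ S, a < b) :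
    ∀ q ∈ partOfBeta S, q ≤ b - S.card := by
  intro q hq
  obtain ⟨-, a, ha, rfl⟩ := mem_partOfBeta.1 hq
  have h1 : gapsBelow S a ≤ (Finset.range b \ S).card := by
    refine Finset.card_le_card (Finset.sdiff_subset_sdiff ?_ le_rfl)
    exact Finset.range_subset_range.2 (h a ha).le
  rwa [Finset.card_sdiff_of_subset (fun a ha => Finset.mem_range.2 (h a ha)),
    Finset.card_range] at h1

lemma betaSet_partOfBeta (S : Finset ℕ) : betaSet (partOfBeta S) S.card = S := by
  induction S using Finset.induction_on_max with
  | empty => simp [betaSet]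
  | insert b S h ih =>
    have hb : b ∉ S := fun hb => lt_irrefl _ (h b hb)
    have hc := card_le_of_forall_lt h
    have hle := le_of_mem_partOfBeta h
    rw [partOfBeta_insert h, Finset.card_insert_of_notMem hb]
    rcases Nat.eq_zero_or_pos (b - S.card) with h0 | h0
    · have hz : partOfBeta S = 0 := by
        refine Multiset.eq_zero_of_forall_notMem fun q hq => ?_
        have := hle q hq
        have := pos_of_mem_partOfBeta S q hq
        omega
      rw [hz, betaSet_zero] at ih
      rw [h0, hz, Multiset.filter_cons_of_neg _ (lt_irrefl 0), Multiset.filter_zero, betaSet_zero,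
        Finset.range_add_one, ih, show S.card = b by omega]
    · rw [filter_pos_eq_self, betaSet_cons hle, ih, Nat.sub_add_cancel hc]
      intro x hx
      rcases Multiset.mem_cons.1 hx with rfl | hx
      · exact h0
      · exact pos_of_mem_partOfBeta S x hx

lemma eq_of_partOfBeta_eq {S T : Finset ℕ} (h : partOfBeta S = partOfBeta T)
    (hc : S.card = T.card) : S = T := by
  rw [← betaSet_partOfBeta S, h, hc, betaSet_partOfBeta]

lemma shiftBeads_eq (S : Finset ℕ) : shiftBeads S = betaSet (partOfBeta S) (S.card + 1) := by
  rw [betaSet_succ (card_partOfBeta_le S), betaSet_partOfBeta]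

lemma partOfBeta_shiftBeads (S : Finset ℕ) : partOfBeta (shiftBeads S) = partOfBeta S := by
  rw [shiftBeads_eq, partOfBeta_betaSet (pos_of_mem_partOfBeta S)]
  exact (card_partOfBeta_le S).trans (Nat.le_succ _)

lemma exists_hook_shiftBeads_iff {e : ℕ} (he : 0 < e) (S : Finset ℕ) (mu : Multiset ℕ) :
    (∃ x ∈ hooks e (shiftBeads S), mu = partOfBeta (moveBead (shiftBeads S) x e)) ↔
      ∃ x ∈ hooks e S, mu = partOfBeta (moveBead S x e) := by
  have key : ∀ x ∈ hooks e S,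
      moveBead (shiftBeads S) (x + 1) e = shiftBeads (moveBead S x e) := by
    intro x hx
    ext a
    simp only [mem_hooks, mem_moveBead, mem_shiftBeads] at *
    rcases a with _ | a
    · simp
    · simp; grind
  constructor
  · rintro ⟨x, hx, rfl⟩
    have hx' : x - 1 ∈ hooks e S ∧ 1 ≤ x := by
      simp only [mem_hooks, mem_shiftBeads] at *
      rcases x with _ | x
      · omega
      · obtain ⟨h1, h2, h3⟩ := hx
        push Not at h3
        refine ⟨⟨by simpa using h1, by omega, fun h => h3.2 _ h ?_⟩, by omega⟩
        omega
    refine ⟨x - 1, hx'.1, ?_⟩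
    have := key _ hx'.1
    rw [Nat.sub_add_cancel hx'.2] at this
    rw [this, partOfBeta_shiftBeads]
  · rintro ⟨x, hx, rfl⟩
    refine ⟨x + 1, ?_, ?_⟩
    · clear key
      rw [mem_hooks] at *
      obtain ⟨h1, h2, h3⟩ := hx
      rw [mem_shiftBeads, mem_shiftBeads]
      refine ⟨Or.inr ⟨x, h1, rfl⟩, by omega, ?_⟩
      rintro (h | ⟨a, ha, h⟩)
      · omega
      · exact h3 (by rwa [show x - e = a by omega])
    · rw [key x hx, partOfBeta_shiftBeads]

lemma exists_hook_betaSet_iff {e m m' : ℕ} (he : 0 < e) {lam : Multiset ℕ} (mu : Multiset ℕ)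
    (h : Multiset.card lam ≤ m) (h' : Multiset.card lam ≤ m') :
    (∃ x ∈ hooks e (betaSet lam m), mu = partOfBeta (moveBead (betaSet lam m) x e)) ↔
      ∃ x ∈ hooks e (betaSet lam m'), mu = partOfBeta (moveBead (betaSet lam m') x e) := by
  have key : ∀ m, Multiset.card lam ≤ m →
      ((∃ x ∈ hooks e (betaSet lam m), mu = partOfBeta (moveBead (betaSet lam m) x e)) ↔
        ∃ x ∈ hooks e (betaSet lam (Multiset.card lam)),
          mu = partOfBeta (moveBead (betaSet lam (Multiset.card lam)) x e)) := by
    intro m hm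
    induction m, hm using Nat.le_induction with
    | base => rfl
    | succ m hm ih => rw [betaSet_succ hm, exists_hook_shiftBeads_iff he, ih]
  rw [key m h, key m' h']

lemma isHookRemoval_partOfBeta_iff {e : ℕ} (he : 0 < e) (S : Finset ℕ) (mu : Multiset ℕ) :
    IsHookRemoval e (partOfBeta S) mu ↔ ∃ x ∈ hooks e S, mu = partOfBeta (moveBead S x e) := by
  constructor
  · rintro ⟨h1, h2, -, m, x, hm, hm', hx, hex, hxe, hmu⟩
    have := (exists_hook_betaSet_iff he mu hm (card_partOfBeta_le S)).1
      ⟨x, mem_hooks.2 ⟨hx, hex, hxe⟩, by rw [moveBead, ← hmu, partOfBeta_betaSet h2 hm']⟩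
    rwa [betaSet_partOfBeta] at this
  · rintro ⟨x, hx, rfl⟩
    have hc := card_moveBead hx
    refine ⟨pos_of_mem_partOfBeta _, pos_of_mem_partOfBeta _, he, S.card, x,
      card_partOfBeta_le S, hc ▸ card_partOfBeta_le _, ?_⟩
    rw [betaSet_partOfBeta, ← hc, betaSet_partOfBeta]
    exact ⟨(mem_hooks.1 hx).1, (mem_hooks.1 hx).2.1, (mem_hooks.1 hx).2.2, rfl⟩

/-- The beads on the runner `b` of the 2-abacus of `S`. -/
def half (b : Bool) (S : Finset ℕ) : Finset ℕ :=
  (S.filter (fun x => x % 2 = b.toNat)).image (fun x => x / 2)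

lemma mem_half {b : Bool} {S : Finset ℕ} {a : ℕ} : a ∈ half b S ↔ 2 * a + b.toNat ∈ S := by
  have hb := Bool.toNat_lt b
  simp only [half, Finset.mem_image, Finset.mem_filter]
  constructor
  · rintro ⟨x, ⟨hx, h⟩, rfl⟩
    rwa [show 2 * (x / 2) + b.toNat = x by omega]
  · exact fun h => ⟨_, ⟨h, by omega⟩, by omega⟩

lemma half_shiftBeads (b : Bool) (S : Finset ℕ) :
    half b (shiftBeads (shiftBeads S)) = shiftBeads (half b S) := by
  have hb := Bool.toNat_lt b
  ext a
  simp only [mem_half, mem_shiftBeads]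
  constructor
  · rintro (h | ⟨c, rfl | ⟨d, hd, rfl⟩, h⟩)
    · left; omega
    · left; omega
    · rcases a with _ | a
      · omega
      · exact Or.inr ⟨a, by rwa [show 2 * a + b.toNat = d by omega], rfl⟩
  · rintro (rfl | ⟨c, hc, rfl⟩)
    · rcases Nat.eq_zero_or_pos b.toNat with h | h
      · left; omega
      · exact Or.inr ⟨0, Or.inl rfl, by omega⟩
    · exact Or.inr ⟨_, Or.inr ⟨_, hc, rfl⟩, by omega⟩

lemma sum_half {M : Type*} [AddCommMonoid M] (S : Finset ℕ) (f : ℕ → M) :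
    ∑ x ∈ S, f x = ∑ a ∈ half false S, f (2 * a) + ∑ a ∈ half true S, f (2 * a + 1) := by
  rw [← Finset.sum_filter_add_sum_filter_not S (fun x => x % 2 = 0)]
  congr 1
  · rw [half, Finset.sum_image]
    · exact Finset.sum_congr rfl fun x hx => by
        rw [Finset.mem_filter, Bool.toNat_false] at hx
        rw [show 2 * (x / 2) = x by omega]
    · intro x hx y hy hxy
      simp only [Finset.mem_coe, Finset.mem_filter, Bool.toNat_false] at hx hy hxy
      omega
  · rw [half, Finset.sum_image]
    · refine Finset.sum_congr ?_ fun x hx => ?_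
      · exact Finset.filter_congr fun x _ => by rw [Bool.toNat_true]; omega
      · simp only [Finset.mem_filter, Bool.toNat_true] at hx
        rw [show 2 * (x / 2) + 1 = x by omega]
    · intro x hx y hy hxy
      simp only [Finset.mem_coe, Finset.mem_filter, Bool.toNat_true] at hx hy hxy
      omega

lemma card_half_add (S : Finset ℕ) : (half false S).card + (half true S).card = S.card := by
  have := sum_half S (fun _ => 1)
  simpa using this.symm

lemma half_hooks (b : Bool) (e : ℕ) (S : Finset ℕ) :
    half b (hooks (2 * e) S) = hooks e (half b S) := by
  ext a
  have hb := Bool.toNat_lt b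
  simp only [mem_half, mem_hooks]
  refine and_congr_right fun _ => ?_
  constructor
  · rintro ⟨h1, h2⟩
    have : e ≤ a := by omega
    exact ⟨this, by rwa [show 2 * (a - e) + b.toNat = 2 * a + b.toNat - 2 * e by omega]⟩
  · rintro ⟨h1, h2⟩
    exact ⟨by omega, by rwa [show 2 * a + b.toNat - 2 * e = 2 * (a - e) + b.toNat by omega]⟩

lemma half_moveBead {b : Bool} {e a : ℕ} (S : Finset ℕ) (h : e ≤ a) :
    half b (moveBead S (2 * a + b.toNat) (2 * e)) = moveBead (half b S) a e := by
  ext c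
  simp only [mem_half, mem_moveBead]
  refine or_congr ?_ (and_congr_left fun _ => ?_) <;> omega

lemma half_not_moveBead {b : Bool} {e a : ℕ} (S : Finset ℕ) (h : e ≤ a) :
    half (!b) (moveBead S (2 * a + b.toNat) (2 * e)) = half (!b) S := by
  ext c
  simp only [mem_half, mem_moveBead]
  have : (!b).toNat + b.toNat = 1 := by cases b <;> rfl
  constructor
  · rintro (h | h)
    · omega
    · exact h.2
  · exact fun h => Or.inr ⟨by omega, h⟩

lemma two_mul_sum_range_id (c : ℕ) : 2 * ((∑ i ∈ Finset.range c, i : ℕ) : ℤ) = c * c - c := by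
  induction c with
  | zero => simp
  | succ c ih => rw [Finset.sum_range_succ]; push_cast at *; linarith

lemma size_half (S : Finset ℕ) :
    2 * (size S : ℤ) = 4 * (size (half false S) + size (half true S)) +
      ((half false S).card - (half true S).card) *
        ((half false S).card - (half true S).card - 1) := by
  have h := size_add_sum_range S
  have h0 := size_add_sum_range (half false S)
  have h1 := size_add_sum_range (half true S)
  have hs := sum_half S (fun b => b)
  rw [Finset.sum_add_distrib, ← Finset.mul_sum, ← Finset.mul_sum] at hs
  simp only [Finset.sum_const, smul_eq_mul, mul_one] at hs
  have hc := card_half_add S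
  have t := two_mul_sum_range_id S.card
  have t0 := two_mul_sum_range_id (half false S).card
  have t1 := two_mul_sum_range_id (half true S).card
  zify at *
  rw [← hc] at t
  nlinarith

lemma two_mul_size_half_le (S : Finset ℕ) :
    2 * (size (half false S) + size (half true S)) ≤ size S := by
  have h := size_half S
  have : (0 : ℤ) ≤ ((half false S).card - (half true S).card) *
        ((half false S).card - (half true S).card - 1) := by
    generalize ((half false S).card - (half true S).card : ℤ) = d
    rcases le_or_gt d 0 with h | h
    · nlinarith
    · exact mul_nonneg h.le (by omega)
  zify
  linarith

lemma exists_mem_hooks_one {S : Finset ℕ} (h : 1 ≤ size S) : ∃ x, x ∈ hooks 1 S := by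
  have h0 : partOfBeta S ≠ 0 := by
    intro h0; rw [size, h0] at h; simp at h
  obtain ⟨p, hp⟩ := Multiset.exists_mem_of_ne_zero h0
  obtain ⟨hp, b, hb, rfl⟩ := mem_partOfBeta.1 hp
  obtain ⟨x, hx, -⟩ := exists_mem_hooks_gapsBelow hb hp
  exact ⟨x, hx⟩

lemma deg_eq_one_of_size_le_one {S : Finset ℕ} (h : size S ≤ 1) : deg S = 1 := by
  rcases Nat.eq_zero_or_pos (size S) with h0 | h0
  · exact deg_eq_one_of_size_eq_zero h0
  obtain ⟨x, hx⟩ := exists_mem_hooks_one h0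
  rw [deg_eq_sum_hooks_one h0, Finset.sum_eq_single_of_mem x hx]
  · exact deg_eq_one_of_size_eq_zero (by have := size_moveBead hx; omega)
  · intro y hy hyx
    have := two_mul_le_size hx hy hyx.symm
    omega

lemma deg_eq_half (S : Finset ℕ) :
    deg S = if size S / 2 = size (half false S) + size (half true S) then
      ((size (half false S) + size (half true S)).choose (size (half false S)) : ZMod 2) *
        deg (half false S) * deg (half true S) else 0 := by
  induction hn : size S using Nat.strong_induction_on generalizing S with
  | _ n ih =>
  have hle := two_mul_size_half_le S
  rcases Nat.lt_or_ge (size S) 2 with h2 | h2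
  · have h0 : size (half false S) = 0 := by omega
    have h1 : size (half true S) = 0 := by omega
    rw [if_pos (by omega), h0, h1, deg_eq_one_of_size_eq_zero h0, deg_eq_one_of_size_eq_zero h1,
      deg_eq_one_of_size_le_one (by omega)]
    simp
  have hsum := deg_eq_sum_hooks 1 (S := S) (by simpa using h2)
  rw [sum_half, show 2 ^ 1 = 2 * 1 from rfl, half_hooks, half_hooks] at hsum
  have e0 : ∀ a ∈ hooks 1 (half false S), deg (moveBead S (2 * a) (2 * 1)) =
      if size S / 2 = size (half false S) + size (half true S) then
      ((size (half false S) + size (half true S) - 1).choose (size (half false S) - 1) : ZMod 2) *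
        deg (half true S) * deg (moveBead (half false S) a 1) else 0 := by
    intro a ha
    have ha1 := (mem_hooks.1 ha).2.1
    have hm : 2 * a ∈ hooks (2 * 1) S := by
      rw [← half_hooks, mem_half] at ha; simpa using ha
    have hs := size_moveBead hm
    have hs' := size_moveBead ha
    have h1 := half_moveBead (b := false) S ha1
    have h2 := half_not_moveBead (b := false) S ha1
    simp only [Bool.toNat_false, add_zero, Bool.not_false] at h1 h2
    rw [ih _ (by omega) _ rfl, h1, h2, ← hs, ← hs']
    refine if_congr (by omega) ?_ rfl
    rw [Nat.add_sub_cancel, show size (moveBead (half false S) a 1) + 1 + size (half true S) - 1 =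
      size (moveBead (half false S) a 1) + size (half true S) by omega]
    ring
  have e1 : ∀ a ∈ hooks 1 (half true S), deg (moveBead S (2 * a + 1) (2 * 1)) =
      if size S / 2 = size (half false S) + size (half true S) then
      ((size (half false S) + size (half true S) - 1).choose (size (half false S)) : ZMod 2) *
        deg (half false S) * deg (moveBead (half true S) a 1) else 0 := by
    intro a ha
    have ha1 := (mem_hooks.1 ha).2.1
    have hm : 2 * a + 1 ∈ hooks (2 * 1) S := by
      rw [← half_hooks, mem_half] at ha; simpa using ha
    have hs := size_moveBead hm
    have hs' := size_moveBead ha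
    have h1 := half_moveBead (b := true) S ha1
    have h2 := half_not_moveBead (b := true) S ha1
    simp only [Bool.toNat_true, Bool.not_true] at h1 h2
    rw [ih _ (by omega) _ rfl, h1, h2, ← hs, ← hs']
    refine if_congr (by omega) ?_ rfl
    rw [show size (half false S) + (size (moveBead (half true S) a 1) + 1) - 1 =
      size (half false S) + size (moveBead (half true S) a 1) by omega]
  rw [Finset.sum_congr rfl e0, Finset.sum_congr rfl e1] at hsum
  rw [hsum]
  subst hn
  split_ifs with hcond
  swap
  · simp
  rw [← Finset.mul_sum, ← Finset.mul_sum]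
  rcases Nat.eq_zero_or_pos (size (half false S)) with h0 | h0 <;>
    rcases Nat.eq_zero_or_pos (size (half true S)) with h1 | h1
  · omega
  · have : hooks 1 (half false S) = ∅ := Finset.eq_empty_of_forall_notMem fun x hx => by
      have := le_size_of_mem_hooks hx
      omega
    rw [this, ← deg_eq_sum_hooks_one h1, h0]
    simp
  · have : hooks 1 (half true S) = ∅ := Finset.eq_empty_of_forall_notMem fun x hx => by
      have := le_size_of_mem_hooks hx
      omega
    rw [this, ← deg_eq_sum_hooks_one h0, h1]
    simp [mul_comm]
  · rw [← deg_eq_sum_hooks_one h0, ← deg_eq_sum_hooks_one h1]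
    obtain ⟨w0, hw0⟩ : ∃ w, size (half false S) = w + 1 := ⟨_, (Nat.sub_add_cancel h0).symm⟩
    rw [hw0, show w0 + 1 + size (half true S) = w0 + size (half true S) + 1 by ring,
      Nat.choose_succ_succ]
    simp only [Nat.add_sub_cancel]
    push_cast
    ring

/-- The components of the 2-quotient of `lam`, indexed by the runners of the 2-abacus. -/
noncomputable def quot (b : Bool) (lam : Multiset ℕ) : Multiset ℕ :=
  if b then (quot2 lam).2 else (quot2 lam).1

lemma quot_eq_partOfBeta_half {b : Bool} {lam : Multiset ℕ} {m : ℕ}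
    (h : Multiset.card lam ≤ m) (hm : Even m) :
    quot b lam = partOfBeta (half b (betaSet lam m)) := by
  have key : ∀ m j, Multiset.card lam ≤ m →
      partOfBeta (half b (betaSet lam (m + 2 * j))) = partOfBeta (half b (betaSet lam m)) := by
    intro m j h
    induction j with
    | zero => rfl
    | succ j ih =>
      rw [show m + 2 * (j + 1) = m + 2 * j + 1 + 1 by ring, betaSet_succ (by omega),
        betaSet_succ (by omega), half_shiftBeads, partOfBeta_shiftBeads, ih]
  have h0 : quot b lam = partOfBeta (half b (betaSet lam (2 * Multiset.card lam))) := by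
    cases b <;> rfl
  obtain ⟨r, rfl⟩ := hm
  rw [h0]
  rcases le_total r (Multiset.card lam) with hr | hr
  · rw [← key (r + r) (Multiset.card lam - r) h]
    congr 3; omega
  · rw [← key (2 * Multiset.card lam) (r - Multiset.card lam) (by omega)]
    congr 3; omega

lemma quot_partOfBeta {S : Finset ℕ} (h : Even S.card) (b : Bool) :
    quot b (partOfBeta S) = partOfBeta (half b S) := by
  rw [quot_eq_partOfBeta_half (card_partOfBeta_le S) h, betaSet_partOfBeta]

lemma exists_even_partOfBeta_eq {lam : Multiset ℕ} (h : ∀ x ∈ lam, 0 < x) :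
    ∃ S : Finset ℕ, Even S.card ∧ partOfBeta S = lam := by
  have hc : Multiset.card lam ≤ 2 * Multiset.card lam := by omega
  refine ⟨betaSet lam (2 * Multiset.card lam), ?_, partOfBeta_betaSet h hc⟩
  rw [card_betaSet hc]
  exact even_two_mul _

lemma oddP_partOfBeta_iff {S : Finset ℕ} : OddP (partOfBeta S) ↔ deg S = 1 := by
  rw [OddP, deg, ZMod.natCast_eq_one_iff_odd]
  exact and_iff_right (pos_of_mem_partOfBeta S)

lemma oddP_iff_quot {lam : Multiset ℕ} (h : ∀ x ∈ lam, 0 < x) (b : Bool) :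
    OddP lam ↔ lam.sum / 2 = (quot b lam).sum + (quot (!b) lam).sum ∧
      Odd (((quot b lam).sum + (quot (!b) lam).sum).choose (quot b lam).sum) ∧
      OddP (quot b lam) ∧ OddP (quot (!b) lam) := by
  have main : OddP lam ↔ lam.sum / 2 = (quot false lam).sum + (quot true lam).sum ∧
      Odd (((quot false lam).sum + (quot true lam).sum).choose (quot false lam).sum) ∧
      OddP (quot false lam) ∧ OddP (quot true lam) := by
    obtain ⟨S, hS, rfl⟩ := exists_even_partOfBeta_eq h
    have hmul : ∀ x y : ZMod 2, x * y = 1 ↔ x = 1 ∧ y = 1 := by decide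
    rw [quot_partOfBeta hS, quot_partOfBeta hS, oddP_partOfBeta_iff, oddP_partOfBeta_iff,
      oddP_partOfBeta_iff, deg_eq_half, ← ZMod.natCast_eq_one_iff_odd]
    change (if size S / 2 = size (half false S) + size (half true S) then _ else _) = _ ↔
      size S / 2 = size (half false S) + size (half true S) ∧ _
    split_ifs with hc
    · rw [hmul, hmul, and_assoc]
      exact (and_iff_right hc).symm
    · simp [hc]
  cases b
  · exact main
  · rw [main, Bool.not_true, add_comm (quot true lam).sum, and_comm (a := OddP (quot true lam)),
      Nat.choose_symm_add]

lemma eq_of_quot_eq {lam mu : Multiset ℕ} (hl : ∀ x ∈ lam, 0 < x) (hm : ∀ x ∈ mu, 0 < x)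
    (hs : lam.sum = mu.sum) (b : Bool) (h : quot b lam = quot b mu)
    (h' : quot (!b) lam = quot (!b) mu) : lam = mu := by
  have hall : ∀ b, quot b lam = quot b mu := by
    intro c
    rcases Bool.eq_or_eq_not c b with rfl | rfl
    · exact h
    · exact h'
  set m := 2 * (Multiset.card lam + Multiset.card mu) with hm_def
  have hcl : Multiset.card lam ≤ m := by omega
  have hcm : Multiset.card mu ≤ m := by omega
  have hev : Even m := even_two_mul _
  have hcS := card_betaSet hcl
  have hcT := card_betaSet hcm
  have hpS := partOfBeta_betaSet hl hcl
  have hpT := partOfBeta_betaSet hm hcm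
  have hq : ∀ b, partOfBeta (half b (betaSet lam m)) = partOfBeta (half b (betaSet mu m)) := by
    intro b
    rw [← quot_eq_partOfBeta_half hcl hev, ← quot_eq_partOfBeta_half hcm hev, hall]
  generalize betaSet lam m = S at *
  generalize betaSet mu m = T at *
  have e1 := size_half S
  have e2 := size_half T
  have c1 := card_half_add S
  have c2 := card_half_add T
  have hsz : size S = size T := by rw [size, size, hpS, hpT, hs]
  have hsz' : ∀ b, size (half b S) = size (half b T) := fun b => by rw [size, size, hq]
  rw [hsz, hsz', hsz', e2] at e1
  have hd : ((half false S).card - (half true S).card - ((half false T).card - (half true T).card)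
      : ℤ) * ((half false S).card - (half true S).card + ((half false T).card - (half true T).card)
        - 1) = 0 := by linarith
  have hcard : (half false S).card = (half false T).card ∧
      (half true S).card = (half true T).card := by
    rcases mul_eq_zero.1 hd with h | h <;> omega
  have hhalf : ∀ b, half b S = half b T := by
    intro b
    refine eq_of_partOfBeta_eq (hq b) ?_
    cases b
    · exact hcard.1
    · exact hcard.2
  rw [← hpS, ← hpT]
  congr 1
  ext x
  have hx : ∃ b : Bool, x = 2 * (x / 2) + b.toNat := by
    rcases Nat.mod_two_eq_zero_or_one x with h | h
    · exact ⟨false, by rw [Bool.toNat_false]; omega⟩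
    · exact ⟨true, by rw [Bool.toNat_true]; omega⟩
  obtain ⟨b, hb⟩ := hx
  rw [hb, ← mem_half, ← mem_half, hhalf]

lemma IsHookRemoval.exists_quot {e : ℕ} {lam mu : Multiset ℕ} (h : IsHookRemoval (2 * e) lam mu) :
    ∃ b, IsHookRemoval e (quot b lam) (quot b mu) ∧ quot (!b) mu = quot (!b) lam := by
  have he : 0 < e := by have := h.2.2.1; omega
  obtain ⟨S, hS, rfl⟩ := exists_even_partOfBeta_eq h.1
  obtain ⟨x, hx, rfl⟩ := (isHookRemoval_partOfBeta_iff h.2.2.1 S mu).1 h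
  obtain ⟨b, a, rfl⟩ : ∃ b : Bool, ∃ a, x = 2 * a + b.toNat := by
    rcases Nat.mod_two_eq_zero_or_one x with h | h
    · exact ⟨false, x / 2, by rw [Bool.toNat_false]; omega⟩
    · exact ⟨true, x / 2, by rw [Bool.toNat_true]; omega⟩
  have hT := card_moveBead hx
  rw [← mem_half, half_hooks] at hx
  have ha := (mem_hooks.1 hx).2.1
  refine ⟨b, ?_, ?_⟩
  · rw [quot_partOfBeta hS, quot_partOfBeta (hT ▸ hS), half_moveBead S ha]
    exact (isHookRemoval_partOfBeta_iff he _ _).2 ⟨a, hx, rfl⟩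
  · rw [quot_partOfBeta hS, quot_partOfBeta (hT ▸ hS), half_not_moveBead S ha]

lemma exists_isHookRemoval_of_quot {e : ℕ} {b : Bool} {lam nu : Multiset ℕ}
    (hl : ∀ x ∈ lam, 0 < x) (h : IsHookRemoval e (quot b lam) nu) :
    ∃ mu, IsHookRemoval (2 * e) lam mu ∧ quot b mu = nu ∧ quot (!b) mu = quot (!b) lam := by
  have he : 0 < e := h.2.2.1
  obtain ⟨S, hS, rfl⟩ := exists_even_partOfBeta_eq hl
  rw [quot_partOfBeta hS] at h
  obtain ⟨a, ha, rfl⟩ := (isHookRemoval_partOfBeta_iff he _ _).1 h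
  have ha' := (mem_hooks.1 ha).2.1
  rw [← half_hooks, mem_half] at ha
  have hT := card_moveBead ha
  refine ⟨_, (isHookRemoval_partOfBeta_iff (by omega) S _).2 ⟨_, ha, rfl⟩, ?_, ?_⟩
  · rw [quot_partOfBeta (hT ▸ hS), half_moveBead S ha']
  · rw [quot_partOfBeta hS, quot_partOfBeta (hT ▸ hS), half_not_moveBead S ha']

lemma IsHookRemoval.sum_add {e : ℕ} {lam mu : Multiset ℕ} (h : IsHookRemoval e lam mu) :
    mu.sum + e = lam.sum := by
  obtain ⟨S, -, rfl⟩ := exists_even_partOfBeta_eq h.1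
  obtain ⟨x, hx, rfl⟩ := (isHookRemoval_partOfBeta_iff h.2.2.1 S mu).1 h
  exact size_moveBead hx

lemma exists_oddP_isHookRemoval {k : ℕ} {lam : Multiset ℕ} (h : OddP lam) (hk : 2 ^ k ≤ lam.sum) :
    ∃ mu, IsHookRemoval (2 ^ k) lam mu ∧ OddP mu := by
  obtain ⟨S, -, rfl⟩ := exists_even_partOfBeta_eq h.1
  obtain ⟨x, hx, hx'⟩ := exists_hook_of_deg (oddP_partOfBeta_iff.1 h) hk
  exact ⟨_, (isHookRemoval_partOfBeta_iff (by positivity) S _).2 ⟨x, hx, rfl⟩,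
    oddP_partOfBeta_iff.2 hx'⟩

lemma land_eq_zero_iff_block {a b : ℕ} (l : ℕ) :
    a &&& b = 0 ↔ a / 2 ^ l &&& b / 2 ^ l = 0 ∧ a % 2 ^ l &&& b % 2 ^ l = 0 := by
  rw [← Nat.and_div_two_pow, ← Nat.and_mod_two_pow]
  constructor
  · rintro h; simp [h]
  · rintro ⟨h1, h2⟩
    have := Nat.div_add_mod (a &&& b) (2 ^ l)
    rw [h1, h2] at this
    simpa using this.symm

lemma land_eq_zero_iff_half {a b : ℕ} :
    a &&& b = 0 ↔ a / 2 &&& b / 2 = 0 ∧ ¬(a % 2 = 1 ∧ b % 2 = 1) := by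
  rw [land_eq_zero_iff_block 1, pow_one, ← Nat.and_mod_two_eq_one]
  have := Nat.and_mod_two_pow (a := a) (b := b) (n := 1)
  rw [pow_one] at this
  rw [← this, Nat.mod_two_not_eq_one]

/-- A binomial coefficient is odd exactly when its two lower entries add without carries. -/
lemma odd_choose_add_iff (a b : ℕ) : Odd ((a + b).choose a) ↔ a &&& b = 0 := by
  induction a using Nat.strong_induction_on generalizing b with
  | _ a ih =>
  rcases Nat.eq_zero_or_pos a with rfl | ha
  · simp
  have hluc : (a + b).choose a ≡ _ [MOD 2] := Choose.choose_modEq_choose_mod_mul_choose_div_nat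
  have hodd : ∀ {x y : ℕ}, x ≡ y [MOD 2] → (Odd x ↔ Odd y) := by
    intro x y h
    rw [Nat.odd_iff, Nat.odd_iff, h]
  rw [hodd hluc, Nat.odd_mul, land_eq_zero_iff_half, ← ih (a / 2) (by omega)]
  rcases Nat.mod_two_eq_zero_or_one a with h1 | h1 <;>
    rcases Nat.mod_two_eq_zero_or_one b with h2 | h2
  · rw [h1, show (a + b) / 2 = a / 2 + b / 2 by omega]; simp
  · rw [h1, show (a + b) / 2 = a / 2 + b / 2 by omega]; simp
  · rw [h1, show (a + b) / 2 = a / 2 + b / 2 by omega, show (a + b) % 2 = 1 by omega]; simp [h2]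
  · rw [h1, show (a + b) % 2 = 0 by omega]; simp [h2]

lemma not_land_sub_one {a b : ℕ} (ha : 0 < a) (hb : 0 < b) (h : a &&& b = 0)
    (h1 : (a - 1) &&& b = 0) (h2 : a &&& (b - 1) = 0) : False := by
  obtain ⟨a, rfl⟩ : ∃ a', a = a' + 1 := ⟨a - 1, by omega⟩
  obtain ⟨b, rfl⟩ : ∃ b', b = b' + 1 := ⟨b - 1, by omega⟩
  rw [Nat.add_sub_cancel] at h1 h2
  rw [← odd_choose_add_iff] at h h1 h2
  rw [show a + 1 + (b + 1) = a + b + 1 + 1 by ring, Nat.choose_succ_succ] at h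
  rw [show a + (b + 1) = a + b + 1 by ring] at h1
  rw [show a + 1 + b = a + b + 1 by ring] at h2
  exact Nat.not_odd_iff_even.2 (h1.add_odd h2) h

lemma sub_div_mod_of_le_mod {a c d : ℕ} (h : c ≤ a % d) (hd : 0 < d) :
    (a - c) / d = a / d ∧ (a - c) % d = a % d - c := by
  have hlt := Nat.mod_lt a hd
  have hdm := Nat.mod_add_div a d
  rw [Nat.div_mod_unique hd]
  generalize d * (a / d) = x at *
  omega

lemma sub_self_div_mod {a d : ℕ} (h : d ≤ a) (hd : 0 < d) :
    (a - d) / d = a / d - 1 ∧ (a - d) % d = a % d := by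
  obtain ⟨a, rfl⟩ := Nat.exists_eq_add_of_le h
  simp [Nat.add_div_left, hd]

lemma sub_div_of_mod_lt {a c d : ℕ} (h : a % d < c) (hc : c ≤ a) (hcd : c ≤ d) :
    0 < a / d ∧ (a - c) / d = a / d - 1 := by
  have hd : 0 < d := by omega
  have hdm := Nat.mod_add_div a d
  have hpos : 0 < a / d := by
    by_contra h0
    rw [Nat.eq_zero_of_not_pos h0] at hdm
    omega
  refine ⟨hpos, ?_⟩
  obtain ⟨q, hq⟩ : ∃ q, a / d = q + 1 := ⟨a / d - 1, by omega⟩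
  rw [hq, mul_add, mul_one] at hdm
  rw [hq, Nat.add_sub_cancel]
  refine ((Nat.div_mod_unique (c := a % d + d - c) hd).2 ⟨?_, ?_⟩).1
  · generalize d * q = x at *
    omega
  · omega

lemma not_land_sub {a b k : ℕ} (ha : 2 ^ k ≤ a) (hb : 2 ^ k ≤ b) (h : a &&& b = 0)
    (h1 : (a - 2 ^ k) &&& b = 0) (h2 : a &&& (b - 2 ^ k) = 0) : False := by
  have hk : 0 < 2 ^ k := by positivity
  rw [land_eq_zero_iff_block k] at h h1 h2
  rw [(sub_self_div_mod ha hk).1] at h1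
  rw [(sub_self_div_mod hb hk).1] at h2
  exact not_land_sub_one (Nat.div_pos ha hk) (Nat.div_pos hb hk) h.1 h1.1 h2.1

lemma land_sub_sub_left {a b k l : ℕ} (hk : 2 ^ k ≤ a % 2 ^ l) (hl : 2 ^ l ≤ a)
    (h1 : (a - 2 ^ k) &&& b = 0) (h2 : (a - 2 ^ l) &&& b = 0) :
    (a - 2 ^ l - 2 ^ k) &&& b = 0 := by
  have hd : 0 < 2 ^ l := by positivity
  have e2 := sub_self_div_mod hl hd
  have e1 := sub_div_mod_of_le_mod hk hd
  have e3 := sub_div_mod_of_le_mod (a := a - 2 ^ l) (c := 2 ^ k) (by rwa [e2.2]) hd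
  rw [land_eq_zero_iff_block l] at *
  rw [e1.2] at h1
  rw [e2.1] at h2
  rw [e3.1, e3.2, e2.1, e2.2]
  exact ⟨h2.1, h1.2⟩

lemma land_sub_sub_right {a b k l : ℕ} (hkl : k ≤ l) (hk : 2 ^ k ≤ a) (hl : 2 ^ l ≤ b)
    (h : a &&& b = 0) (h1 : (a - 2 ^ k) &&& b = 0) (h2 : a &&& (b - 2 ^ l) = 0) :
    (a - 2 ^ k) &&& (b - 2 ^ l) = 0 ∧ 2 ^ k ≤ a % 2 ^ l := by
  have hd : 0 < 2 ^ l := by positivity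
  have e2 := sub_self_div_mod hl hd
  have hle : 2 ^ k ≤ a % 2 ^ l := by
    by_contra hlt
    obtain ⟨hpos, e1⟩ := sub_div_of_mod_lt (not_le.1 hlt) hk (Nat.pow_le_pow_right two_pos hkl)
    rw [land_eq_zero_iff_block l] at h h1 h2
    rw [e1] at h1
    rw [e2.1] at h2
    exact not_land_sub_one hpos (Nat.div_pos hl hd) h.1 h1.1 h2.1
  refine ⟨?_, hle⟩
  have e1 := sub_div_mod_of_le_mod hle hd
  rw [land_eq_zero_iff_block l] at *
  rw [e1.2] at h1
  rw [e2.1] at h2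
  rw [e1.1, e1.2, e2.1, e2.2]
  exact ⟨h2.1, h1.2⟩

lemma add_lt_two_pow_of_land {a b l : ℕ} (ha : a < 2 ^ l) (hb : b < 2 ^ l) (h : a &&& b = 0) :
    a + b < 2 ^ l := by
  induction l generalizing a b with
  | zero => simp at *; omega
  | succ l ih =>
    rw [land_eq_zero_iff_half] at h
    rw [pow_succ] at *
    have := ih (a := a / 2) (b := b / 2) (by omega) (by omega) h.1
    omega

lemma mod_le_add_mod_of_land {a b : ℕ} (l : ℕ) (h : a &&& b = 0) :
    a % 2 ^ l ≤ (a + b) % 2 ^ l := by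
  have hd : 0 < 2 ^ l := by positivity
  rw [Nat.add_mod, Nat.mod_eq_of_lt (add_lt_two_pow_of_land (Nat.mod_lt a hd) (Nat.mod_lt b hd)
    ((land_eq_zero_iff_block l).1 h).2)]
  exact Nat.le_add_right _ _

lemma OddP.quot {lam : Multiset ℕ} (h : OddP lam) (b : Bool) : OddP (quot b lam) :=
  ((oddP_iff_quot h.1 b).1 h).2.2.1

lemma OddP.sum_div_two {lam : Multiset ℕ} (h : OddP lam) (b : Bool) :
    lam.sum / 2 = (OddSym.quot b lam).sum + (OddSym.quot (!b) lam).sum :=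
  ((oddP_iff_quot h.1 b).1 h).1

lemma OddP.land {lam : Multiset ℕ} (h : OddP lam) (b : Bool) :
    (OddSym.quot b lam).sum &&& (OddSym.quot (!b) lam).sum = 0 :=
  (odd_choose_add_iff _ _).1 ((oddP_iff_quot h.1 b).1 h).2.1

/-- `mu` is obtained from the odd partition `lam` by removing an odd `2 ^ k`-hook. -/
structure OddHook (k : ℕ) (lam mu : Multiset ℕ) : Prop where
  removal : IsHookRemoval (2 ^ k) lam mu
  left : OddP lam
  right : OddP mu

lemma OddHook.sum_add {k : ℕ} {lam mu : Multiset ℕ} (h : OddHook k lam mu) :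
    mu.sum + 2 ^ k = lam.sum := h.removal.sum_add

lemma OddHook.exists_quot {k : ℕ} {lam mu : Multiset ℕ} (h : OddHook (k + 1) lam mu) :
    ∃ b, OddHook k (quot b lam) (quot b mu) ∧ quot (!b) mu = quot (!b) lam := by
  have h1 := h.removal
  rw [pow_succ'] at h1
  obtain ⟨b, hb, hb'⟩ := h1.exists_quot
  exact ⟨b, ⟨hb, h.left.quot b, h.right.quot b⟩, hb'⟩

lemma OddHook.unique {k : ℕ} {lam mu nu : Multiset ℕ} (h : OddHook k lam mu)
    (h' : OddHook k lam nu) : mu = nu := by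
  induction k generalizing lam mu nu with
  | zero =>
    obtain ⟨S, -, rfl⟩ := exists_even_partOfBeta_eq h.left.1
    obtain ⟨x, hx, rfl⟩ := (isHookRemoval_partOfBeta_iff one_pos S mu).1 h.removal
    obtain ⟨y, hy, rfl⟩ := (isHookRemoval_partOfBeta_iff one_pos S nu).1 h'.removal
    rw [hook_one_unique (oddP_partOfBeta_iff.1 h.left) hx (oddP_partOfBeta_iff.1 h.right) hy
      (oddP_partOfBeta_iff.1 h'.right)]
  | succ k ih =>
    have hs : mu.sum = nu.sum := by
      have := h.sum_add
      have := h'.sum_add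
      omega
    obtain ⟨b, hb, hb'⟩ := h.exists_quot
    obtain ⟨c, hc, hc'⟩ := h'.exists_quot
    rcases Bool.eq_or_eq_not c b with rfl | rfl
    · exact eq_of_quot_eq h.right.1 h'.right.1 hs c (ih hb hc) (hb'.trans hc'.symm)
    · rw [Bool.not_not] at hc'
      have s1 := hb.sum_add
      have s2 := hc.sum_add
      have l1 := h.right.land b
      have l2 := h'.right.land b
      rw [hb', Nat.eq_sub_of_add_eq s1] at l1
      rw [hc', Nat.eq_sub_of_add_eq s2] at l2
      exact (not_land_sub (by omega) (by omega) (h.left.land b) l1 l2).elim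

lemma OddHook.fkOp_eq {k : ℕ} {lam mu : Multiset ℕ} (h : OddHook k lam mu) :
    fkOp k lam = mu := by
  have hex : ∃ mu, IsHookRemoval (2 ^ k) lam mu ∧ OddP mu := ⟨mu, h.removal, h.right⟩
  rw [fkOp, dif_pos hex]
  exact OddHook.unique ⟨hex.choose_spec.1, h.left, hex.choose_spec.2⟩ h

lemma OddP.exists_oddHook {k : ℕ} {lam : Multiset ℕ} (h : OddP lam) (hk : 2 ^ k ≤ lam.sum) :
    ∃ mu, OddHook k lam mu := by
  obtain ⟨mu, h1, h2⟩ := exists_oddP_isHookRemoval h hk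
  exact ⟨mu, h1, h, h2⟩

lemma towerRow_succ_eq_append (k : ℕ) (lam : Multiset ℕ) :
    towerRow (k + 1) lam = towerRow k (quot false lam) ++ towerRow k (quot true lam) := by
  induction k with
  | zero => rfl
  | succ k ih => rw [towerRow, ih, List.flatMap_append]; rfl

lemma length_towerRow (k : ℕ) (lam : Multiset ℕ) : (towerRow k lam).length = 2 ^ k := by
  induction k generalizing lam with
  | zero => rfl
  | succ k ih => rw [towerRow_succ_eq_append, List.length_append, ih, ih]; ring

lemma OddHook.exists_towerRow_eq_set {j k : ℕ} {lam mu : Multiset ℕ} (h : OddHook j lam mu)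
    (hk : k ≤ j) : ∃ s, s < 2 ^ k ∧ towerRow k mu =
      (towerRow k lam).set s (fkOp (j - k) ((towerRow k lam).getD s 0)) := by
  induction k generalizing j lam mu with
  | zero => exact ⟨0, by simp, by simp [towerRow, h.fkOp_eq]⟩
  | succ k ih =>
    obtain ⟨j, rfl⟩ : ∃ j', j = j' + 1 := ⟨j - 1, by omega⟩
    obtain ⟨b, hb, hb'⟩ := h.exists_quot
    obtain ⟨s, hs, hs'⟩ := ih hb (by omega)
    have hlen := length_towerRow k
    rw [towerRow_succ_eq_append, towerRow_succ_eq_append, Nat.add_sub_add_right]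
    cases b
    · rw [Bool.not_false] at hb'
      refine ⟨s, by rw [pow_succ]; omega, ?_⟩
      rw [hb', hs', List.getD_append _ _ _ _ (by rwa [hlen]),
        List.set_append_left _ _ (by rwa [hlen])]
    · rw [Bool.not_true] at hb'
      refine ⟨2 ^ k + s, by rw [pow_succ]; omega, ?_⟩
      rw [hb', hs', List.getD_append_right _ _ _ _ (by rw [hlen]; omega),
        List.set_append_right _ _ (by rw [hlen]; omega), hlen, Nat.add_sub_cancel_left]

/-- At every position of row `k` of the 2-quotient tower, at least one of `mu` and `nu` agrees
with `lam`. -/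
def Separated (k : ℕ) (lam mu nu : Multiset ℕ) : Prop :=
  ∀ i : ℕ, (towerRow k mu)[i]? = (towerRow k lam)[i]? ∨ (towerRow k nu)[i]? = (towerRow k lam)[i]?

lemma Separated.quot {k : ℕ} {lam mu nu : Multiset ℕ} (h : Separated (k + 1) lam mu nu)
    (b : Bool) : Separated k (quot b lam) (quot b mu) (quot b nu) := by
  intro i
  have hlen := length_towerRow k
  simp only [Separated, towerRow_succ_eq_append] at h
  cases b
  · by_cases hi : i < 2 ^ k
    · have := h i
      rwa [List.getElem?_append_left (by rwa [hlen]), List.getElem?_append_left (by rwa [hlen]),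
        List.getElem?_append_left (by rwa [hlen])] at this
    · left
      rw [List.getElem?_eq_none (by rw [hlen]; omega), List.getElem?_eq_none (by rw [hlen]; omega)]
  · have := h (2 ^ k + i)
    rwa [List.getElem?_append_right (by rw [hlen]; omega),
      List.getElem?_append_right (by rw [hlen]; omega),
      List.getElem?_append_right (by rw [hlen]; omega), hlen, hlen, hlen,
      Nat.add_sub_cancel_left] at this

lemma separated_of_Rcomp_ne {j k l : ℕ} {lam mu nu : Multiset ℕ} (hj : k ≤ j) (hl : k ≤ l)
    (hm : OddHook j lam mu) (hn : OddHook l lam nu) (h : Rcomp k j lam ≠ Rcomp k l lam) :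
    Separated k lam mu nu := by
  have h1 := hm.exists_towerRow_eq_set hj
  have h2 := hn.exists_towerRow_eq_set hl
  rw [← hm.fkOp_eq] at h1
  rw [← hn.fkOp_eq] at h2
  rw [Rcomp, Rcomp, dif_pos h1, dif_pos h2] at h
  have hne : h1.choose ≠ h2.choose := fun he => h (by rw [he])
  intro i
  rw [← hm.fkOp_eq, ← hn.fkOp_eq, h1.choose_spec.2, h2.choose_spec.2]
  by_cases hi : h1.choose = i
  · right
    exact List.getElem?_set_ne (fun h => hne (hi.trans h.symm))
  · left
    exact List.getElem?_set_ne hi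

lemma oddHook_commute {k l : ℕ} {lam mu nu : Multiset ℕ} (hkl : k < l) (hm : OddHook k lam mu)
    (hn : OddHook l lam nu) (hs : Separated k lam mu nu) :
    2 ^ k ≤ lam.sum % 2 ^ l ∧ ∃ rho, OddHook l mu rho ∧ OddHook k nu rho := by
  induction k generalizing l lam mu nu with
  | zero =>
    have sm := hm.sum_add
    have sn := hn.sum_add
    have := Nat.two_pow_pos l
    rcases hs 0 with h | h
    · have h : mu = lam := by simpa [towerRow] using h
      rw [h] at sm
      omega
    · have h : nu = lam := by simpa [towerRow] using h
      rw [h] at sn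
      omega
  | succ k ih =>
    obtain ⟨l, rfl⟩ : ∃ l', l = l' + 1 := ⟨l - 1, by omega⟩
    have sm := hm.sum_add
    have sn := hn.sum_add
    obtain ⟨b, hb, hb'⟩ := hm.exists_quot
    obtain ⟨c, hc, hc'⟩ := hn.exists_quot
    have tm := hb.sum_add
    have tn := hc.sum_add
    have hodd := hm.left
    have hsum := hodd.sum_div_two b
    have hland := hodd.land b
    have lm := hm.right.land b
    have ln := hn.right.land b
    have hmod : 2 ^ k ≤ (quot b lam).sum % 2 ^ l → 2 ^ (k + 1) ≤ lam.sum % 2 ^ (l + 1) := by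
      intro h
      have := mod_le_add_mod_of_land l hland
      rw [pow_succ', pow_succ', Nat.mod_mul, hsum]
      omega
    suffices 2 ^ k ≤ (quot b lam).sum % 2 ^ l ∧ ∃ rho rho',
        IsHookRemoval (2 * 2 ^ l) mu rho ∧ IsHookRemoval (2 * 2 ^ k) nu rho' ∧
        quot b rho = quot b rho' ∧ quot (!b) rho = quot (!b) rho' ∧
        (quot b rho).sum &&& (quot (!b) rho).sum = 0 ∧
        (quot b rho).sum + (quot (!b) rho).sum + 2 ^ k + 2 ^ l =
          (quot b lam).sum + (quot (!b) lam).sum ∧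
        OddP (quot b rho) ∧ OddP (quot (!b) rho) by
      obtain ⟨hle, rho, rho', h1, h2, h3, h4, h5, h6, h7, h8⟩ := this
      have s1 := h1.sum_add
      have s2 := h2.sum_add
      rw [pow_succ'] at sm sn
      obtain rfl : rho = rho' := eq_of_quot_eq h1.2.1 h2.2.1 (by omega) b h3 h4
      have hodd : OddP rho := (oddP_iff_quot h1.2.1 b).2
        ⟨by omega, (odd_choose_add_iff _ _).2 h5, h7, h8⟩
      rw [← pow_succ'] at h1 h2
      exact ⟨hmod hle, rho, ⟨h1, hm.right, hodd⟩, ⟨h2, hn.right, hodd⟩⟩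
    rcases Bool.eq_or_eq_not c b with rfl | rfl
    · obtain ⟨hle, sigma, h1, h2⟩ := ih (by omega) hb hc (hs.quot c)
      have t1 := h1.sum_add
      obtain ⟨rho, r1, r2, r3⟩ := exists_isHookRemoval_of_quot hm.right.1 h1.removal
      obtain ⟨rho', r1', r2', r3'⟩ := exists_isHookRemoval_of_quot hn.right.1 h2.removal
      rw [hb'] at r3 lm
      rw [hc'] at r3' ln
      refine ⟨hle, rho, rho', r1, r1', r2.trans r2'.symm, r3.trans r3'.symm, ?_, ?_, ?_, ?_⟩
      · rw [r2, r3, show sigma.sum = (quot c lam).sum - 2 ^ l - 2 ^ k by omega]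
        refine land_sub_sub_left hle (by omega) ?_ ?_
        · rwa [← Nat.eq_sub_of_add_eq tm]
        · rwa [← Nat.eq_sub_of_add_eq tn]
      · rw [r2, r3]; omega
      · rw [r2]; exact h1.right
      · rw [r3]; exact hodd.quot _
    · rw [Bool.not_not] at hc'
      have h1 := hc.removal
      have h2 := hb.removal
      rw [← hb'] at h1
      rw [← hc'] at h2
      obtain ⟨rho, r1, r2, r3⟩ := exists_isHookRemoval_of_quot hm.right.1 h1
      obtain ⟨rho', r1', r2', r3'⟩ := exists_isHookRemoval_of_quot hn.right.1 h2
      rw [Bool.not_not] at r3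
      rw [hb', Nat.eq_sub_of_add_eq tm] at lm
      rw [hc', Nat.eq_sub_of_add_eq tn] at ln
      obtain ⟨hl1, hle⟩ := land_sub_sub_right (by omega) (by omega) (by omega) hland lm ln
      refine ⟨hle, rho, rho', r1, r1', r3.trans r2'.symm, r2.trans r3'.symm, ?_, ?_, ?_, ?_⟩
      · rwa [r2, r3, Nat.eq_sub_of_add_eq tm, Nat.eq_sub_of_add_eq tn]
      · rw [r2, r3]; omega
      · rw [r3]; exact hb.right
      · rw [r2]; exact hc.right

theorem stmt16 (k l n : ℕ) (hkl : k < l) (h : 2 ^ k + 2 ^ l ≤ n)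
    (lam : Multiset ℕ) (hodd : OddP lam) (hsum : lam.sum = n)
    (hne : Rcomp k k lam ≠ Rcomp k l lam) :
    fkOp k (fkOp l lam) = fkOp l (fkOp k lam) := by
  subst hsum
  obtain ⟨mu, hm⟩ := hodd.exists_oddHook ((Nat.le_add_right _ _).trans h)
  obtain ⟨nu, hn⟩ := hodd.exists_oddHook ((Nat.le_add_left _ _).trans h)
  obtain ⟨-, rho, h1, h2⟩ :=
    oddHook_commute hkl hm hn (separated_of_Rcomp_ne le_rfl hkl.le hm hn hne)
  rw [hm.fkOp_eq, hn.fkOp_eq, h1.fkOp_eq, h2.fkOp_eq]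

end OddSym
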